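/- (Shifted hook-length formula.) Let λ be a strict partition. Then f^λ · ∏_{u ∈ [λ]^B} h^B(u) = |λ|! and f^λ · ∏_{u ∈ [λ]^D} h^D(u) = |λ|!, where f^λ is the number of standard Young tableaux of shifted shape λ. -/

import Mathlib

attribute [local instance] Classical.propDecidable

/-- `l : ℕ → ℕ` encodes a strict partition: the parts are `l 1 > l 2 > ⋯ > l ℓ > 0`
(indexed from `1`), with `l i = 0` for `i > ℓ` (and `l 0 = 0` by convention). -/
def IsStrictPartition (l : ℕ → ℕ) : Prop :=
  l 0 = 0 ∧ ∀ i, 1 ≤ i → (l i = 0 → l (i + 1) = 0) ∧ (l i ≠ 0 → l (i + 1) < l i)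

/-- The shifted diagram of type B: cells `(i,j)` with `1 ≤ i ≤ ℓ(λ)` and
`i ≤ j ≤ λ_i + i - 1`.  (For a strict partition all such cells satisfy
`i ≤ l 1` and `j ≤ 2 * l 1 + 2`, so the ambient box loses nothing.) -/
noncomputable def cellsB (l : ℕ → ℕ) : Finset (ℕ × ℕ) :=
  (Finset.Icc 1 (l 1) ×ˢ Finset.Icc 1 (2 * l 1 + 2)).filter
    (fun p => p.1 ≤ p.2 ∧ p.2 < l p.1 + p.1)

/-- The shifted diagram of type D: cells `(i,j)` with `1 ≤ i ≤ ℓ(λ)` and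
`i + 1 ≤ j ≤ λ_i + i`. -/
noncomputable def cellsD (l : ℕ → ℕ) : Finset (ℕ × ℕ) :=
  (Finset.Icc 1 (l 1) ×ˢ Finset.Icc 1 (2 * l 1 + 2)).filter
    (fun p => p.1 < p.2 ∧ p.2 ≤ l p.1 + p.1)

/-- `λ'_k`: the number of cells of `[λ]^B` in column `k`. -/
noncomputable def colB (l : ℕ → ℕ) (k : ℕ) : ℕ :=
  ((cellsB l).filter (fun p => p.2 = k)).card

/-- The size `|λ|` of a strict partition. -/
noncomputable def spSize (l : ℕ → ℕ) : ℕ := ∑ i ∈ Finset.Icc 1 (l 1), l i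

/-- The length `ℓ(λ)` (number of nonzero parts) of a strict partition. -/
noncomputable def spLength (l : ℕ → ℕ) : ℕ :=
  ((Finset.Icc 1 (l 1)).filter (fun i => l i ≠ 0)).card

/-- `μ ⋖ ν` for strict partitions (containment via type B diagrams and `|ν| = |μ| + 1`). -/
def CoversB (m n : ℕ → ℕ) : Prop :=
  cellsB m ⊆ cellsB n ∧ spSize n = spSize m + 1

/-- `μ ⋖ ν` for strict partitions (containment via type D diagrams and `|ν| = |μ| + 1`). -/
def CoversD (m n : ℕ → ℕ) : Prop :=
  cellsD m ⊆ cellsD n ∧ spSize n = spSize m + 1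

/-- An excited move of type B with respect to `λ`. -/
def ExcitedMoveB (l : ℕ → ℕ) (D D' : Finset (ℕ × ℕ)) : Prop :=
  ∃ i j : ℕ, (i, j) ∈ D ∧
    (i + 1, j) ∈ cellsB l ∧ (i + 1, j) ∉ D ∧
    (i, j + 1) ∈ cellsB l ∧ (i, j + 1) ∉ D ∧
    (i + 1, j + 1) ∈ cellsB l ∧ (i + 1, j + 1) ∉ D ∧
    D' = insert (i + 1, j + 1) (D.erase (i, j))

/-- The excited diagrams of type B of shape `λ/μ`: subsets of `[λ]^B` obtainable from
`[μ]^B` by finite sequences of excited moves of type B. -/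
noncomputable def EB (l m : ℕ → ℕ) : Finset (Finset (ℕ × ℕ)) :=
  (cellsB l).powerset.filter
    (fun D => Relation.ReflTransGen (ExcitedMoveB l) (cellsB m) D)

/-- An excited move of type D with respect to `λ`. -/
def ExcitedMoveD (l : ℕ → ℕ) (D D' : Finset (ℕ × ℕ)) : Prop :=
  (∃ i j : ℕ, i + 1 < j ∧ (i, j) ∈ D ∧
    (i + 1, j) ∈ cellsD l ∧ (i + 1, j) ∉ D ∧
    (i, j + 1) ∈ cellsD l ∧ (i, j + 1) ∉ D ∧
    (i + 1, j + 1) ∈ cellsD l ∧ (i + 1, j + 1) ∉ D ∧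
    D' = insert (i + 1, j + 1) (D.erase (i, j))) ∨
  (∃ i : ℕ, (i, i + 1) ∈ D ∧
    (i, i + 2) ∈ cellsD l ∧ (i, i + 2) ∉ D ∧
    (i, i + 3) ∈ cellsD l ∧ (i, i + 3) ∉ D ∧
    (i + 1, i + 2) ∈ cellsD l ∧ (i + 1, i + 2) ∉ D ∧
    (i + 1, i + 3) ∈ cellsD l ∧ (i + 1, i + 3) ∉ D ∧
    (i + 2, i + 3) ∈ cellsD l ∧ (i + 2, i + 3) ∉ D ∧
    D' = insert (i + 2, i + 3) (D.erase (i, i + 1)))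

/-- The excited diagrams of type D of shape `λ/μ`. -/
noncomputable def ED (l m : ℕ → ℕ) : Finset (Finset (ℕ × ℕ)) :=
  (cellsD l).powerset.filter
    (fun D => Relation.ReflTransGen (ExcitedMoveD l) (cellsD m) D)

/-- The set `W^B(μ, λ)`: all `1 ≤ k ≤ ℓ(λ)` with `λ_k ≠ μ_i` for all `i ≥ 1`, together
with all `k ≥ ℓ(λ) + 1` with `λ'_k - k ≠ μ'_i - i` for all `i ≥ 1`.  (All its elements
are at most `λ_1 + μ_1 + 2`, so the ambient interval loses nothing.) -/
noncomputable def WB (m l : ℕ → ℕ) : Finset ℕ :=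
  (Finset.Icc 1 (l 1 + m 1 + 2)).filter (fun k =>
    (k ≤ spLength l ∧ ∀ i, 1 ≤ i → l k ≠ m i) ∨
    (spLength l + 1 ≤ k ∧ ∀ i, 1 ≤ i → (colB l k : ℤ) - k ≠ (colB m i : ℤ) - i))

/-- The set `W^D(μ, λ)`. -/
noncomputable def WD (m l : ℕ → ℕ) : Finset ℕ :=
  (Finset.Icc 1 (l 1 + m 1 + 3)).filter (fun k =>
    (k ≤ spLength l ∧ ∀ i, 1 ≤ i → l k ≠ m i) ∨
    (k = spLength l + 1 ∧ Odd ((spLength l : ℤ) - (spLength m : ℤ))) ∨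
    (spLength l + 2 ≤ k ∧ ∀ i, 1 ≤ i → (colB l k : ℤ) - k ≠ (colB m i : ℤ) - i))

/-- The type B hook length of a cell of `[λ]^B`. -/
noncomputable def hB (l : ℕ → ℕ) (p : ℕ × ℕ) : ℤ :=
  if p.1 = p.2 then (l p.1 : ℤ)
  else if p.2 ≤ spLength l then (l p.1 : ℤ) + (l p.2 : ℤ)
  else ((l p.1 : ℤ) + (p.1 : ℤ) - (p.2 : ℤ)) + ((colB l p.2 : ℤ) - (p.1 : ℤ))

/-- The type D hook length of a cell of `[λ]^D`. -/
noncomputable def hD (l : ℕ → ℕ) (p : ℕ × ℕ) : ℤ :=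
  if p.2 ≤ spLength l then (l p.1 : ℤ) + (l p.2 : ℤ)
  else ((l p.1 : ℤ) + (p.1 : ℤ) - (p.2 : ℤ) + 1) + ((colB l (p.2 - 1) : ℤ) - (p.1 : ℤ))

/-- A standard Young tableau on a finite set of cells, encoded as `T : ℕ × ℕ → ℕ`
which is `0` off the cells and restricts to a bijection onto `{1, …, n}`,
increasing along rows and columns. -/
def IsSYT (cells : Finset (ℕ × ℕ)) (T : ℕ × ℕ → ℕ) : Prop :=
  Set.BijOn T ↑cells ↑(Finset.Icc 1 cells.card) ∧
  (∀ p, p ∉ cells → T p = 0) ∧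
  (∀ i j : ℕ, (i, j) ∈ cells → (i, j + 1) ∈ cells → T (i, j) < T (i, j + 1)) ∧
  (∀ i j : ℕ, (i, j) ∈ cells → (i + 1, j) ∈ cells → T (i, j) < T (i + 1, j))

/-- The skew diagram `[λ]^B ∖ [μ]^B`. -/
noncomputable def skewB (l m : ℕ → ℕ) : Finset (ℕ × ℕ) := cellsB l \ cellsB m

/-- The skew diagram `[λ]^D ∖ [μ]^D`. -/
noncomputable def skewD (l m : ℕ → ℕ) : Finset (ℕ × ℕ) := cellsD l \ cellsD m

/-- `f^{λ/μ}`: the number of standard Young tableaux of shifted skew shape `λ/μ`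
(type B diagrams). -/
noncomputable def fB (l m : ℕ → ℕ) : ℕ :=
  Nat.card {T : ℕ × ℕ → ℕ // IsSYT (skewB l m) T}

/-- `f^{λ/μ}` via the type D diagrams. -/
noncomputable def fD (l m : ℕ → ℕ) : ℕ :=
  Nat.card {T : ℕ × ℕ → ℕ // IsSYT (skewD l m) T}

/-- `x_k^B = λ_k` for `k ≤ ℓ(λ)` and `x_k^B = λ'_k - k` for `k > ℓ(λ)`. -/
noncomputable def xB (l : ℕ → ℕ) (k : ℕ) : ℤ :=
  if k ≤ spLength l then (l k : ℤ) else (colB l k : ℤ) - (k : ℤ)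

/-- `x_k^D = λ_k` for `k ≤ ℓ(λ)` and `x_k^D = λ'_{k-1} - k + 1` for `k > ℓ(λ)`. -/
noncomputable def xD (l : ℕ → ℕ) (k : ℕ) : ℤ :=
  if k ≤ spLength l then (l k : ℤ) else (colB l (k - 1) : ℤ) - (k : ℤ) + 1

/-- The weighted type B hook length `h^B(u; z)`: the sum of `z_{c(v)}` over the cells `v`
of the type B hook of `u` (the diagonal cell `(j,j)` counted twice when `i < j ≤ ℓ(λ)`). -/
noncomputable def hBz (l : ℕ → ℕ) (z : ℕ → ℝ) (u : ℕ × ℕ) : ℝ :=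
  (∑ p ∈ (cellsB l).filter (fun p => p.1 = u.1 ∧ u.2 ≤ p.2), z (p.2 - p.1)) +
  (∑ p ∈ (cellsB l).filter (fun p => p.2 = u.2 ∧ u.1 < p.1), z (p.2 - p.1)) +
  (if u.1 < u.2 ∧ u.2 ≤ spLength l then
      ∑ p ∈ (cellsB l).filter (fun p => p.1 = u.2), z (p.2 - p.1)
    else 0)

/-- The weighted type D hook length `h^D(u; z)`. -/
noncomputable def hDz (l : ℕ → ℕ) (z : ℕ → ℝ) (u : ℕ × ℕ) : ℝ :=
  (∑ p ∈ (cellsD l).filter (fun p => p.1 = u.1 ∧ u.2 ≤ p.2), z (p.2 - p.1)) +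
  (∑ p ∈ (cellsD l).filter (fun p => p.2 = u.2 ∧ u.1 < p.1), z (p.2 - p.1)) +
  (∑ p ∈ (cellsD l).filter (fun p => p.1 = u.2), z (p.2 - p.1))

/-- The weight `T_z` of a standard Young tableau `T` on `cells` (with `n = |cells|`):
`∏_{k=1}^n (z_{c(T⁻¹(n))} + ⋯ + z_{c(T⁻¹(k))})⁻¹`. -/
noncomputable def Tz (cells : Finset (ℕ × ℕ)) (z : ℕ → ℝ) (T : ℕ × ℕ → ℕ) : ℝ :=
  ∏ k ∈ Finset.Icc 1 cells.card,
    (∑ p ∈ cells.filter (fun p => k ≤ T p), z (p.2 - p.1))⁻¹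

/-- `x_k^B(z) = z_0 + ⋯ + z_{λ_k - 1}` for `k ≤ ℓ(λ)`, and
`x_k^B(z) = -(z_0 + ⋯ + z_{k - λ'_k - 1})` for `k > ℓ(λ)`. -/
noncomputable def xBz (l : ℕ → ℕ) (z : ℕ → ℝ) (k : ℕ) : ℝ :=
  if k ≤ spLength l then ∑ t ∈ Finset.range (l k), z t
  else -∑ t ∈ Finset.range (k - colB l k), z t



lemma sh_ident (S : Finset ℕ) (x : ℕ → ℚ)
    (h : ∀ i ∈ S, ∀ j ∈ S, i ≠ j → x i - x j ≠ 0 ∧ x i + x j - 1 ≠ 0) :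
    ∑ i ∈ S, x i * ∏ j ∈ S.erase i,
      ((x i - x j - 1) * (x i + x j) / ((x i - x j) * (x i + x j - 1))) = ∑ i ∈ S, x i := by
  rcases S.eq_empty_or_nonempty with rfl | hne
  · simp
  have hpos : 0 < S.card := Finset.card_pos.mpr hne
  set u : ℕ → ℚ := fun i => x i * (x i - 1) with hu
  set v : ℕ → ℚ := fun i => x i * (x i + 1) with hv
  have hinj : Set.InjOn u S := by
    intro i hi j hj hij
    by_contra hne
    obtain ⟨h1, h2⟩ := h i hi j hj hne
    apply mul_ne_zero h1 h2
    simp only [hu] at hij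
    linear_combination hij
  have hdeg : (Lagrange.nodal S v - Lagrange.nodal S u).degree < (S.card : WithBot ℕ) := by
    have := Polynomial.degree_sub_lt_left (p := Lagrange.nodal S v) (q := Lagrange.nodal S u)
      (by simp [Lagrange.degree_nodal]) (Lagrange.nodal_ne_zero)
      (by rw [(Lagrange.nodal_monic).leadingCoeff, (Lagrange.nodal_monic).leadingCoeff])
    rwa [Lagrange.degree_nodal] at this
  have key := Lagrange.coeff_eq_sum hinj hdeg
  rw [Polynomial.coeff_sub, Lagrange.nodal_eq, Lagrange.nodal_eq,
    Polynomial.prod_X_sub_C_coeff_card_pred _ _ hpos,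
    Polynomial.prod_X_sub_C_coeff_card_pred _ _ hpos] at key
  have e1 : -∑ i ∈ S, v i - -∑ i ∈ S, u i = -2 * ∑ i ∈ S, x i := by
    rw [Finset.mul_sum, ← Finset.sum_neg_distrib, ← Finset.sum_neg_distrib,
      ← Finset.sum_sub_distrib]
    refine Finset.sum_congr rfl fun i _ => ?_
    simp only [hu, hv]; ring
  rw [e1] at key
  have e2 : ∀ i ∈ S, Polynomial.eval (u i) (∏ i ∈ S, (Polynomial.X - Polynomial.C (v i)) -
      ∏ i ∈ S, (Polynomial.X - Polynomial.C (u i))) / ∏ j ∈ S.erase i, (u i - u j) =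
      -2 * (x i * ∏ j ∈ S.erase i,
      ((x i - x j - 1) * (x i + x j) / ((x i - x j) * (x i + x j - 1)))) := by
    intro i hi
    rw [← Lagrange.nodal_eq, ← Lagrange.nodal_eq, Polynomial.eval_sub,
      Lagrange.eval_nodal_at_node hi, sub_zero, Lagrange.eval_nodal,
      ← Finset.mul_prod_erase S _ hi, mul_div_assoc, ← Finset.prod_div_distrib, ← mul_assoc]
    congr 1
    · simp only [hu, hv]; ring
    · refine Finset.prod_congr rfl fun j _ => ?_
      simp only [hu, hv]
      congr 1 <;> ring
  rw [Finset.sum_congr rfl e2, ← Finset.mul_sum] at key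
  linarith

noncomputable def maxCells (C : Finset (ℕ × ℕ)) : Finset (ℕ × ℕ) :=
  C.filter (fun c => (c.1, c.2 + 1) ∉ C ∧ (c.1 + 1, c.2) ∉ C)

lemma syt_extend {C : Finset (ℕ × ℕ)} {c : ℕ × ℕ} (hc : c ∈ maxCells C) {T : ℕ × ℕ → ℕ}
    (hT : IsSYT (C.erase c) T) : IsSYT C (fun p => if p = c then C.card else T p) := by
  obtain ⟨hb, h0, hr, hd⟩ := hT
  simp only [maxCells, Finset.mem_filter] at hc
  obtain ⟨hcC, hc1, hc2⟩ := hc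
  have hcard := Finset.card_erase_of_mem hcC
  have hpos : 0 < C.card := Finset.card_pos.mpr ⟨c, hcC⟩
  have hlt : ∀ p, T p < C.card := by
    intro p
    by_cases hp : p ∈ C.erase c
    · have := hb.mapsTo hp
      simp only [Finset.coe_Icc, Set.mem_Icc] at this
      omega
    · rw [h0 p hp]; exact hpos
  refine ⟨⟨?_, ?_, ?_⟩, ?_, ?_, ?_⟩
  · intro p hp
    by_cases hpc : p = c
    · simp only [hpc, if_true, Finset.coe_Icc, Set.mem_Icc]; omega
    · have := hb.mapsTo (Finset.mem_coe.mpr (Finset.mem_erase.mpr ⟨hpc, hp⟩))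
      simp only [Finset.coe_Icc, Set.mem_Icc] at this
      simp [hpc]; omega
  · intro p hp q hq hpq
    simp only at hpq
    have := hlt p
    have := hlt q
    split_ifs at hpq with h1 h2 h2
    · rw [h1, h2]
    · omega
    · omega
    · exact hb.injOn (Finset.mem_coe.mpr (Finset.mem_erase.mpr ⟨h1, hp⟩))
        (Finset.mem_coe.mpr (Finset.mem_erase.mpr ⟨h2, hq⟩)) hpq
  · intro k hk
    simp only [Finset.coe_Icc, Set.mem_Icc] at hk
    by_cases hkc : k = C.card
    · exact ⟨c, hcC, by simp [hkc]⟩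
    · obtain ⟨p, hp, hpk⟩ := hb.surjOn (show k ∈ _ by
        simp only [Finset.coe_Icc, Set.mem_Icc]; omega)
      have hp' := Finset.mem_erase.mp (Finset.mem_coe.mp hp)
      exact ⟨p, hp'.2, by simp [hp'.1, hpk]⟩
  · intro p hp
    have hpc : p ≠ c := fun h => hp (h ▸ hcC)
    simp only [hpc, if_false]
    exact h0 p (fun h => hp (Finset.mem_of_mem_erase h))
  · intro i j h1 h2
    have hne : (i, j) ≠ c := by rintro rfl; exact hc1 h2
    simp only [hne, if_false]
    split_ifs with h3
    · exact hlt _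
    · exact hr i j (Finset.mem_erase.mpr ⟨hne, h1⟩) (Finset.mem_erase.mpr ⟨h3, h2⟩)
  · intro i j h1 h2
    have hne : (i, j) ≠ c := by rintro rfl; exact hc2 h2
    simp only [hne, if_false]
    split_ifs with h3
    · exact hlt _
    · exact hd i j (Finset.mem_erase.mpr ⟨hne, h1⟩) (Finset.mem_erase.mpr ⟨h3, h2⟩)

lemma syt_restrict {C : Finset (ℕ × ℕ)} {c : ℕ × ℕ} (hcC : c ∈ C) {T : ℕ × ℕ → ℕ}
    (hT : IsSYT C T) (hTc : T c = C.card) :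
    c ∈ maxCells C ∧ IsSYT (C.erase c) (fun p => if p = c then 0 else T p) := by
  obtain ⟨hb, h0, hr, hd⟩ := hT
  have hle : ∀ p ∈ C, 1 ≤ T p ∧ T p ≤ C.card := by
    intro p hp
    have := hb.mapsTo (Finset.mem_coe.mpr hp)
    simpa only [Finset.coe_Icc, Set.mem_Icc] using this
  have hcard := Finset.card_erase_of_mem hcC
  refine ⟨?_, ⟨?_, ?_, ?_⟩, ?_, ?_, ?_⟩
  · simp only [maxCells, Finset.mem_filter]
    refine ⟨hcC, fun h => ?_, fun h => ?_⟩
    · have := hr c.1 c.2 hcC h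
      have := hle _ h
      simp only [Prod.mk.eta] at *
      omega
    · have := hd c.1 c.2 hcC h
      have := hle _ h
      simp only [Prod.mk.eta] at *
      omega
  · intro p hp
    have hp' := Finset.mem_erase.mp (Finset.mem_coe.mp hp)
    have h1 := hle p hp'.2
    have h2 : T p ≠ C.card := fun h => hp'.1 (hb.injOn hp'.2 hcC (h.trans hTc.symm))
    simp only [hp'.1, if_false, Finset.coe_Icc, Set.mem_Icc]
    omega
  · intro p hp q hq hpq
    have hp' := Finset.mem_erase.mp (Finset.mem_coe.mp hp)
    have hq' := Finset.mem_erase.mp (Finset.mem_coe.mp hq)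
    simp only [hp'.1, hq'.1, if_false] at hpq
    exact hb.injOn hp'.2 hq'.2 hpq
  · intro k hk
    simp only [Finset.coe_Icc, Set.mem_Icc] at hk
    obtain ⟨p, hp, hpk⟩ := hb.surjOn (show k ∈ _ by
        simp only [Finset.coe_Icc, Set.mem_Icc]; omega)
    have hpc : p ≠ c := by rintro rfl; omega
    exact ⟨p, Finset.mem_coe.mpr (Finset.mem_erase.mpr ⟨hpc, hp⟩), by simp [hpc, hpk]⟩
  · intro p hp
    by_cases hpc : p = c
    · simp [hpc]
    · simp only [hpc, if_false]
      exact h0 p (fun h => hp (Finset.mem_erase.mpr ⟨hpc, h⟩))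
  · intro i j h1 h2
    rw [Finset.mem_erase] at h1 h2
    simp only [h1.1, h2.1, if_false]
    exact hr i j h1.2 h2.2
  · intro i j h1 h2
    rw [Finset.mem_erase] at h1 h2
    simp only [h1.1, h2.1, if_false]
    exact hd i j h1.2 h2.2

noncomputable def sytGlue (C : Finset (ℕ × ℕ))
    (x : Σ c : {c // c ∈ maxCells C}, {T // IsSYT (C.erase c) T}) : {T // IsSYT C T} :=
  ⟨fun p => if p = x.1.1 then C.card else x.2.1 p, syt_extend x.1.2 x.2.2⟩

lemma sytGlue_bij (C : Finset (ℕ × ℕ)) (hC : C.Nonempty) : Function.Bijective (sytGlue C) := by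
  have hpos : 0 < C.card := Finset.card_pos.mpr hC
  constructor
  · rintro ⟨⟨c, hc⟩, T, hT⟩ ⟨⟨d, hd⟩, T', hT'⟩ h
    have h := congrArg Subtype.val h
    simp only [sytGlue] at h
    have hcd : c = d := by
      by_contra hne
      have h1 := congrFun h c
      simp only [if_true, hne, if_false] at h1
      have hcC : c ∈ C := Finset.mem_of_mem_filter c hc
      have hdC : d ∈ C := Finset.mem_of_mem_filter d hd
      have h2 := hT'.1.mapsTo (Finset.mem_coe.mpr (Finset.mem_erase.mpr ⟨hne, hcC⟩))
      simp only [Finset.coe_Icc, Set.mem_Icc] at h2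
      have := Finset.card_erase_of_mem hdC
      omega
    subst hcd
    have hTT : T = T' := by
      funext p
      by_cases hp : p = c
      · rw [hT.2.1 p (by simp [hp]), hT'.2.1 p (by simp [hp])]
      · simpa [hp] using congrFun h p
    subst hTT
    rfl
  · rintro ⟨T, hT⟩
    obtain ⟨c, hc, hTc⟩ := hT.1.surjOn (show C.card ∈ _ by
      simp only [Finset.coe_Icc, Set.mem_Icc]; omega)
    obtain ⟨h1, h2⟩ := syt_restrict hc hT hTc
    refine ⟨⟨⟨c, h1⟩, _, h2⟩, ?_⟩
    apply Subtype.ext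
    funext p
    simp only [sytGlue]
    split_ifs with hp
    · rw [hp, hTc]
    · rfl

lemma syt_finite : ∀ (n : ℕ) (C : Finset (ℕ × ℕ)), C.card = n → Finite {T // IsSYT C T} := by
  intro n
  induction n with
  | zero =>
    intro C hC
    rw [Finset.card_eq_zero] at hC
    subst hC
    have : Subsingleton {T // IsSYT ∅ T} := ⟨fun a b => Subtype.ext (funext fun p => by
      rw [a.2.2.1 p (by simp), b.2.2.1 p (by simp)])⟩
    infer_instance
  | succ n ih =>
    intro C hC
    have hne : C.Nonempty := Finset.card_pos.mp (by omega)
    have : ∀ c : {c // c ∈ maxCells C}, Finite {T // IsSYT (C.erase c) T} := by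
      rintro ⟨c, hc⟩
      have hcC : c ∈ C := Finset.mem_of_mem_filter c hc
      exact ih _ (by rw [Finset.card_erase_of_mem hcC]; omega)
    exact Finite.of_surjective _ (sytGlue_bij C hne).2

lemma syt_rec (C : Finset (ℕ × ℕ)) (hC : C.Nonempty) :
    Nat.card {T // IsSYT C T} = ∑ c ∈ maxCells C, Nat.card {T // IsSYT (C.erase c) T} := by
  have : ∀ c : {c // c ∈ maxCells C}, Finite {T // IsSYT (C.erase c) T} :=
    fun c => syt_finite _ _ rfl
  rw [← Nat.card_eq_of_bijective _ (sytGlue_bij C hC), Nat.card_sigma]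
  exact Finset.sum_coe_sort (maxCells C) (fun c => Nat.card {T // IsSYT (C.erase c) T})

lemma syt_empty : Nat.card {T // IsSYT ∅ T} = 1 := by
  have : Subsingleton {T // IsSYT ∅ T} := ⟨fun a b => Subtype.ext (funext fun p => by
      rw [a.2.2.1 p (by simp), b.2.2.1 p (by simp)])⟩
  have : Nonempty {T // IsSYT ∅ T} := ⟨⟨fun _ => 0, by simp [IsSYT]⟩⟩
  exact Nat.card_of_subsingleton (Classical.arbitrary _)

lemma sp_zero {l : ℕ → ℕ} (hl : IsStrictPartition l) {i : ℕ} (hi : 1 ≤ i) (h : l i = 0) :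
    ∀ j, i ≤ j → l j = 0 := by
  intro j hj
  induction j, hj using Nat.le_induction with
  | base => exact h
  | succ k hk ih => exact (hl.2 k (by omega)).1 ih

lemma sp_lt {l : ℕ → ℕ} (hl : IsStrictPartition l) {i : ℕ} (hi : 1 ≤ i) (h : l i ≠ 0) :
    ∀ j, i < j → l j < l i := by
  intro j hj
  induction j, hj using Nat.le_induction with
  | base => exact (hl.2 i hi).2 h
  | succ k hk ih =>
    by_cases h0 : l k = 0
    · have := (hl.2 k (by omega)).1 h0
      omega
    · have := (hl.2 k (by omega)).2 h0
      omega

lemma sp_add {l : ℕ → ℕ} (hl : IsStrictPartition l) {i : ℕ} (hi : 1 ≤ i) :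
    ∀ j, i ≤ j → l j ≠ 0 → l j + j ≤ l i + i := by
  intro j hj
  induction j, hj using Nat.le_induction with
  | base => intro _; exact le_refl _
  | succ k hk ih =>
    intro h
    have h0 : l k ≠ 0 := fun h0 => h ((hl.2 k (by omega)).1 h0)
    have := (hl.2 k (by omega)).2 h0
    have := ih h0
    omega

lemma mem_cellsB {l : ℕ → ℕ} (hl : IsStrictPartition l) (i j : ℕ) :
    (i, j) ∈ cellsB l ↔ 1 ≤ i ∧ i ≤ j ∧ j < l i + i := by
  simp only [cellsB, Finset.mem_filter, Finset.mem_product, Finset.mem_Icc]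
  constructor
  · rintro ⟨⟨⟨h1, h2⟩, h3, h4⟩, h5, h6⟩
    exact ⟨h1, h5, h6⟩
  · rintro ⟨h1, h2, h3⟩
    have := sp_add hl le_rfl i h1 (by omega)
    omega

lemma mem_cellsD {l : ℕ → ℕ} (hl : IsStrictPartition l) (i j : ℕ) :
    (i, j) ∈ cellsD l ↔ 1 ≤ i ∧ i < j ∧ j ≤ l i + i := by
  simp only [cellsD, Finset.mem_filter, Finset.mem_product, Finset.mem_Icc]
  constructor
  · rintro ⟨⟨⟨h1, h2⟩, h3, h4⟩, h5, h6⟩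
    exact ⟨h1, h5, h6⟩
  · rintro ⟨h1, h2, h3⟩
    have := sp_add hl le_rfl i h1 (by omega)
    omega

noncomputable def remPart (l : ℕ → ℕ) (i : ℕ) : ℕ → ℕ := fun k => if k = i then l i - 1 else l k

def IsRem (l : ℕ → ℕ) (i : ℕ) : Prop := 1 ≤ i ∧ l i ≠ 0 ∧ (l i = 1 ∨ l (i + 1) + 1 < l i)

lemma remPart_strict {l : ℕ → ℕ} (hl : IsStrictPartition l) {i : ℕ} (hi : IsRem l i) :
    IsStrictPartition (remPart l i) := by
  obtain ⟨h1, h2, h3⟩ := hi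
  refine ⟨by have := hl.1; simp only [remPart]; split_ifs <;> omega, fun k hk => ?_⟩
  have a := hl.2 k hk
  simp only [remPart]
  split_ifs with h4 h5 h5
  · omega
  · subst h4; omega
  · subst h5; omega
  · exact a

lemma cellsB_remPart {l : ℕ → ℕ} (hl : IsStrictPartition l) {i : ℕ} (hi : IsRem l i) :
    cellsB (remPart l i) = (cellsB l).erase (i, l i + i - 1) := by
  ext ⟨a, b⟩
  rw [Finset.mem_erase, mem_cellsB hl, mem_cellsB (remPart_strict hl hi)]
  obtain ⟨h1, h2, h3⟩ := hi
  simp only [remPart, ne_eq, Prod.mk.injEq]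
  split_ifs with h
  · subst h; omega
  · omega

lemma maxCells_cellsB {l : ℕ → ℕ} (hl : IsStrictPartition l) {M : ℕ} (hM : ∀ i, M < i → l i = 0) :
    maxCells (cellsB l) =
      ((Finset.Icc 1 M).filter (IsRem l)).image (fun i => (i, l i + i - 1)) := by
  ext ⟨a, b⟩
  simp only [maxCells, Finset.mem_filter, Finset.mem_image, mem_cellsB hl, Finset.mem_Icc, IsRem,
    Prod.mk.injEq]
  constructor
  · rintro ⟨⟨h1, h2, h3⟩, h4, h5⟩
    have : a ≤ M := by
      by_contra hc
      have := hM a (by omega)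
      omega
    refine ⟨a, ⟨⟨h1, this⟩, h1, ?_, ?_⟩, rfl, ?_⟩ <;> omega
  · rintro ⟨i, ⟨⟨h1, h2⟩, h3, h4, h5⟩, rfl, rfl⟩
    omega

noncomputable def gq (a b : ℕ) : ℚ := if b = 0 then 1 else ((a : ℚ) - b) / (a + b)

noncomputable def Gq (l : ℕ → ℕ) (M : ℕ) : ℚ :=
  ∏ i ∈ Finset.Icc 1 M, (1 / ((l i).factorial : ℚ) * ∏ j ∈ Finset.Ioc i M, gq (l i) (l j))

noncomputable def rat (a b : ℚ) : ℚ := (a - b - 1) * (a + b) / ((a - b) * (a + b - 1))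

lemma pair_prod (M i : ℕ) (hi : i ∈ Finset.Icc 1 M) (t : ℕ → ℚ) :
    ∏ a ∈ Finset.Icc 1 M, ∏ b ∈ Finset.Ioc a M,
      (if a = i then t b else if b = i then t a else 1) = ∏ j ∈ (Finset.Icc 1 M).erase i, t j := by
  rw [← Finset.mul_prod_erase _ _ hi]
  have h1 : ∀ a ∈ (Finset.Icc 1 M).erase i, (∏ b ∈ Finset.Ioc a M,
      (if a = i then t b else if b = i then t a else 1)) = if a < i then t a else 1 := by
    intro a ha
    have hai : a ≠ i := Finset.ne_of_mem_erase ha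
    simp only [hai, if_false]
    rw [Finset.prod_ite_eq']
    simp only [Finset.mem_Ioc, Finset.mem_Icc] at hi ⊢
    simp only [hi.2, and_true]
  rw [Finset.prod_congr rfl h1]
  simp only [if_true]
  rw [← Finset.prod_filter]
  rw [← Finset.prod_filter_mul_prod_filter_not ((Finset.Icc 1 M).erase i) (fun a => a < i), mul_comm]
  congr 1
  apply Finset.prod_congr _ (fun _ _ => rfl)
  ext b
  simp only [Finset.mem_Icc, Finset.mem_Ioc, Finset.mem_filter, Finset.mem_erase] at *
  omega

lemma gq_step1 (a b : ℕ) (h : b < a) :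
    gq (a - 1) b = gq a b * (if b = 0 then 1 else rat a b) := by
  unfold gq rat
  split_ifs with hb
  · simp
  · obtain ⟨c, rfl⟩ : ∃ c, a = b + 1 + c := ⟨a - (b + 1), by omega⟩
    have e : b + 1 + c - 1 = b + c := by omega
    rw [e]
    have hb' : (0 : ℚ) < b := by exact_mod_cast Nat.pos_of_ne_zero hb
    have hc : (0 : ℚ) ≤ c := by positivity
    push_cast
    have h1 : (b : ℚ) + c + b ≠ 0 := by positivity
    have h2 : (b : ℚ) + 1 + c + b ≠ 0 := by positivity
    have h3 : (b : ℚ) + 1 + c - b ≠ 0 := by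
      have : (b : ℚ) + 1 + c - b = 1 + c := by ring
      rw [this]; positivity
    have h4 : (b : ℚ) + 1 + c + b - 1 ≠ 0 := by
      have : (b : ℚ) + 1 + c + b - 1 = b + c + b := by ring
      rwa [this]
    field_simp
    ring

lemma gq_step2 (a b : ℕ) (hb : b ≠ 0) (h : b < a) :
    gq a (b - 1) = gq a b * rat b a := by
  unfold gq rat
  obtain ⟨c, rfl⟩ : ∃ c, a = b + 1 + c := ⟨a - (b + 1), by omega⟩
  obtain ⟨d, rfl⟩ : ∃ d, b = d + 1 := ⟨b - 1, by omega⟩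
  have hc : (0 : ℚ) ≤ c := by positivity
  have hd : (0 : ℚ) ≤ d := by positivity
  simp only [Nat.add_sub_cancel, hb, if_false]
  push_cast
  have h2 : (d : ℚ) + 1 + 1 + c + (d + 1) ≠ 0 := by positivity
  have h3 : (d : ℚ) + 1 - (d + 1 + 1 + c) ≠ 0 := by
    have : (d : ℚ) + 1 - (d + 1 + 1 + c) = -(1 + c) := by ring
    rw [this]; exact neg_ne_zero.mpr (by positivity)
  have h4 : (d : ℚ) + 1 + (d + 1 + 1 + c) - 1 ≠ 0 := by
    have : (d : ℚ) + 1 + (d + 1 + 1 + c) - 1 = d + 1 + d + 1 + c := by ring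
    rw [this]; positivity
  have h5 : (d : ℚ) + 1 + 1 + c + d ≠ 0 := by positivity
  split_ifs with h0
  · subst h0
    push_cast at *
    field_simp
    ring
  · field_simp
    ring

lemma Gq_step {l : ℕ → ℕ} (hl : IsStrictPartition l) {M i : ℕ} (hi : i ∈ Finset.Icc 1 M)
    (h0 : l i ≠ 0) :
    Gq (remPart l i) M = Gq l M * ((l i : ℚ) *
      ∏ j ∈ ((Finset.Icc 1 M).filter (fun j => l j ≠ 0)).erase i, rat (l i) (l j)) := by
  have hi1 := (Finset.mem_Icc.mp hi).1
  set t : ℕ → ℚ := fun j => if l j = 0 then 1 else rat (l i) (l j) with ht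
  have e1 : ∏ j ∈ ((Finset.Icc 1 M).filter (fun j => l j ≠ 0)).erase i, rat (l i) (l j) =
      ∏ j ∈ (Finset.Icc 1 M).erase i, t j := by
    have : ((Finset.Icc 1 M).filter (fun j => l j ≠ 0)).erase i =
        ((Finset.Icc 1 M).erase i).filter (fun j => l j ≠ 0) := by
      ext j
      simp only [Finset.mem_erase, Finset.mem_filter]
      tauto
    rw [this, Finset.prod_filter]
    refine Finset.prod_congr rfl fun j _ => ?_
    simp only [ht, ne_eq, ite_not]
  rw [e1, ← pair_prod M i hi t]
  have e2 : (l i : ℚ) = ∏ a ∈ Finset.Icc 1 M, (if a = i then (l i : ℚ) else 1) := by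
    rw [Finset.prod_ite_eq', if_pos hi]
  rw [e2, ← Finset.prod_mul_distrib]
  unfold Gq
  rw [← Finset.prod_mul_distrib]
  refine Finset.prod_congr rfl fun a ha => ?_
  have ha1 := (Finset.mem_Icc.mp ha).1
  have e3 : ∏ b ∈ Finset.Ioc a M, gq (remPart l i a) (remPart l i b) =
      (∏ b ∈ Finset.Ioc a M, gq (l a) (l b)) *
      ∏ b ∈ Finset.Ioc a M, (if a = i then t b else if b = i then t a else 1) := by
    rw [← Finset.prod_mul_distrib]
    refine Finset.prod_congr rfl fun b hb => ?_
    have hab := (Finset.mem_Ioc.mp hb).1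
    simp only [remPart, ht]
    by_cases h1 : a = i
    · subst h1
      rw [if_pos rfl, if_neg hab.ne', if_pos rfl]
      exact gq_step1 _ _ (sp_lt hl ha1 h0 b hab)
    · rw [if_neg h1, if_neg h1]
      by_cases h2 : b = i
      · subst h2
        have hla : l a ≠ 0 := fun h => h0 (sp_zero hl ha1 h b hab.le)
        rw [if_pos rfl, if_pos rfl, if_neg hla]
        exact gq_step2 _ _ h0 (sp_lt hl ha1 hla b hab)
      · rw [if_neg h2, if_neg h2, mul_one]
  have e4 : 1 / ((remPart l i a).factorial : ℚ) =
      1 / ((l a).factorial : ℚ) * (if a = i then (l i : ℚ) else 1) := by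
    simp only [remPart]
    split_ifs with h
    · subst h
      have hf := Nat.mul_factorial_pred h0
      have h5 : ((l a - 1).factorial : ℚ) ≠ 0 := by positivity
      have h6 : (l a : ℚ) ≠ 0 := by exact_mod_cast h0
      rw [← hf]
      push_cast
      field_simp
    · rw [mul_one]
  rw [e3, e4]
  ring

lemma Gq_sum {l : ℕ → ℕ} (hl : IsStrictPartition l) {M : ℕ} (hM : ∀ i, M < i → l i = 0) :
    ((∑ i ∈ Finset.Icc 1 M, l i : ℕ) : ℚ) * Gq l M =
      ∑ i ∈ (Finset.Icc 1 M).filter (IsRem l), Gq (remPart l i) M := by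
  have hS : (Finset.Icc 1 M).filter (IsRem l) ⊆ (Finset.Icc 1 M).filter (fun j => l j ≠ 0) := by
    intro i hi
    simp only [Finset.mem_filter, IsRem] at *
    tauto
  have hstep : ∀ i ∈ (Finset.Icc 1 M).filter (fun j => l j ≠ 0), Gq (remPart l i) M =
      Gq l M * ((l i : ℚ) *
      ∏ j ∈ ((Finset.Icc 1 M).filter (fun j => l j ≠ 0)).erase i, rat (l i) (l j)) := by
    intro i hi
    rw [Finset.mem_filter] at hi
    exact Gq_step hl hi.1 hi.2
  rw [Finset.sum_subset hS, Finset.sum_congr rfl hstep, ← Finset.mul_sum, mul_comm]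
  · congr 1
    have := sh_ident ((Finset.Icc 1 M).filter (fun j => l j ≠ 0)) (fun i => (l i : ℚ)) ?_
    · unfold rat
      rw [this]
      push_cast
      rw [Finset.sum_filter_of_ne]
      intro x _ hx
      exact_mod_cast hx
    · intro i hi j hj hij
      simp only [Finset.mem_filter, Finset.mem_Icc] at hi hj
      have hne : l i ≠ l j := by
        rcases lt_or_gt_of_ne hij with h | h
        · exact (sp_lt hl hi.1.1 hi.2 j h).ne'
        · exact (sp_lt hl hj.1.1 hj.2 i h).ne
      refine ⟨sub_ne_zero.mpr (by exact_mod_cast hne), sub_ne_zero.mpr ?_⟩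
      have : l i + l j ≠ 1 := by omega
      exact_mod_cast this
  · intro i hi hni
    rw [hstep i hi]
    simp only [Finset.mem_filter, Finset.mem_Icc, IsRem] at hi hni
    have h1 := (hl.2 i hi.1.1).2 hi.2
    have h2 : l i = l (i + 1) + 1 ∧ l (i + 1) ≠ 0 := by
      constructor
      · by_contra hc
        exact hni ⟨hi.1, hi.1.1, hi.2, by omega⟩
      · intro hc
        exact hni ⟨hi.1, hi.1.1, hi.2, by omega⟩
    have h3 : i + 1 ≤ M := by
      by_contra hc
      exact h2.2 (hM _ (by omega))
    rw [Finset.prod_eq_zero (i := i + 1), mul_zero, mul_zero]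
    · simp only [Finset.mem_erase, Finset.mem_filter, Finset.mem_Icc]
      exact ⟨by omega, ⟨by omega, h3⟩, h2.2⟩
    · unfold rat
      rw [h2.1]
      push_cast
      simp

lemma main_count (M : ℕ) : ∀ (n : ℕ) (l : ℕ → ℕ), IsStrictPartition l →
    (∀ i, M < i → l i = 0) → ∑ i ∈ Finset.Icc 1 M, l i = n →
    (Nat.card {T // IsSYT (cellsB l) T} : ℚ) = n.factorial * Gq l M := by
  intro n
  induction n with
  | zero =>
    intro l hl hM hs
    have hz : ∀ i, 1 ≤ i → l i = 0 := by
      intro i hi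
      by_cases h : i ≤ M
      · exact (Finset.sum_eq_zero_iff.mp hs) i (Finset.mem_Icc.mpr ⟨hi, h⟩)
      · exact hM i (by omega)
    have hc : cellsB l = ∅ := by
      ext ⟨a, b⟩
      rw [mem_cellsB hl]
      simp only [Finset.notMem_empty, iff_false]
      rintro ⟨h1, h2, h3⟩
      have := hz a h1
      omega
    rw [hc, syt_empty]
    have : Gq l M = 1 := by
      unfold Gq
      refine Finset.prod_eq_one fun i hi => ?_
      rw [Finset.mem_Icc] at hi
      rw [hz i hi.1, Finset.prod_eq_one]
      · simp
      · intro j hj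
        rw [Finset.mem_Ioc] at hj
        rw [hz j (by omega)]
        simp [gq]
    simp [this]
  | succ n ih =>
    intro l hl hM hs
    have hne : (cellsB l).Nonempty := by
      obtain ⟨i, hi, hi0⟩ := Finset.exists_ne_zero_of_sum_ne_zero
        (show ∑ i ∈ Finset.Icc 1 M, l i ≠ 0 by omega)
      rw [Finset.mem_Icc] at hi
      exact ⟨(i, i), (mem_cellsB hl i i).mpr ⟨hi.1, le_rfl, by omega⟩⟩
    rw [syt_rec _ hne, maxCells_cellsB hl hM, Finset.sum_image]
    · push_cast
      have hG := Gq_sum hl hM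
      rw [hs] at hG
      have : ∀ i ∈ (Finset.Icc 1 M).filter (IsRem l),
          (Nat.card {T // IsSYT ((cellsB l).erase (i, l i + i - 1)) T} : ℚ) =
          n.factorial * Gq (remPart l i) M := by
        intro i hi
        rw [Finset.mem_filter] at hi
        rw [← cellsB_remPart hl hi.2]
        apply ih _ (remPart_strict hl hi.2)
        · intro k hk
          have := hM k hk
          have h2 := Finset.mem_Icc.mp hi.1
          simp only [remPart]
          rw [if_neg (by omega)]
          exact this
        · have h1 := Finset.add_sum_erase _ l hi.1
          have h2 := Finset.add_sum_erase _ (remPart l i) hi.1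
          have h3 : ∑ x ∈ (Finset.Icc 1 M).erase i, remPart l i x =
              ∑ x ∈ (Finset.Icc 1 M).erase i, l x := by
            refine Finset.sum_congr rfl fun x hx => ?_
            simp [remPart, Finset.ne_of_mem_erase hx]
          have h4 : remPart l i i = l i - 1 := by simp [remPart]
          have h5 := hi.2.2.1
          omega
      rw [Finset.sum_congr rfl this, ← Finset.mul_sum, ← hG, Nat.factorial_succ]
      push_cast
      ring
    · intro a _ b _ hab
      exact (Prod.mk.inj hab).1

lemma prod_Icc_fact (n : ℕ) : ∏ k ∈ Finset.Icc 1 n, k = n.factorial := by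
  induction n with
  | zero => rfl
  | succ n ih =>
    rw [Finset.prod_Icc_succ_top (by omega), ih, Nat.factorial_succ, mul_comm]

lemma downset (S : Finset ℕ) (h1 : ∀ k ∈ S, 1 ≤ k) (h2 : ∀ k ∈ S, ∀ m, 1 ≤ m → m ≤ k → m ∈ S)
    (k : ℕ) (hk : 1 ≤ k) : k ∈ S ↔ k ≤ S.card := by
  constructor
  · intro h
    have : Finset.Icc 1 k ⊆ S := fun m hm => by
      rw [Finset.mem_Icc] at hm
      exact h2 k h m hm.1 hm.2
    simpa using Finset.card_le_card this
  · intro h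
    by_contra hn
    have : S ⊆ Finset.Icc 1 (k - 1) := fun m hm => by
      rw [Finset.mem_Icc]
      refine ⟨h1 m hm, ?_⟩
      by_contra hc
      exact hn (h2 m hm k hk (by omega))
    have := Finset.card_le_card this
    simp at this
    omega

lemma le_spLength {l : ℕ → ℕ} (hl : IsStrictPartition l) {i : ℕ} (hi : 1 ≤ i) :
    i ≤ spLength l ↔ l i ≠ 0 := by
  unfold spLength
  rw [← downset _ _ _ i hi]
  · rw [Finset.mem_filter, Finset.mem_Icc]
    constructor
    · exact fun h => h.2
    · intro h
      have := sp_add hl le_rfl i hi h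
      omega
  · intro k hk
    rw [Finset.mem_filter, Finset.mem_Icc] at hk
    exact hk.1.1
  · intro k hk m hm hmk
    rw [Finset.mem_filter, Finset.mem_Icc] at *
    exact ⟨by omega, fun h => hk.2 (sp_zero hl hm h k hmk)⟩

lemma colB_eq {l : ℕ → ℕ} (hl : IsStrictPartition l) (j : ℕ) :
    colB l j = ((Finset.Icc 1 j).filter (fun k => j < l k + k)).card := by
  unfold colB
  refine Finset.card_nbij' (fun p => p.1) (fun k => (k, j)) ?_ ?_ ?_ ?_
  · rintro ⟨a, b⟩ h
    simp only [Finset.coe_filter, Set.mem_ofPred_eq, mem_cellsB hl, Finset.mem_Icc] at *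
    omega
  · intro k h
    simp only [Finset.coe_filter, Set.mem_ofPred_eq, mem_cellsB hl, Finset.mem_Icc] at *
    exact ⟨⟨h.1.1, h.1.2, h.2⟩, trivial⟩
  · rintro ⟨a, b⟩ h
    simp only [Finset.coe_filter, Set.mem_ofPred_eq] at *
    rw [h.2]
  · intro k _
    rfl

lemma colB_le {l : ℕ → ℕ} (hl : IsStrictPartition l) (j : ℕ) : colB l j ≤ j := by
  rw [colB_eq hl]
  exact (Finset.card_filter_le _ _).trans (by simp)

lemma le_colB {l : ℕ → ℕ} (hl : IsStrictPartition l) {j k : ℕ} (hk : 1 ≤ k) (hkj : k ≤ j) :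
    k ≤ colB l j ↔ j < l k + k := by
  rw [colB_eq hl, ← downset _ _ _ k hk]
  · rw [Finset.mem_filter, Finset.mem_Icc]
    tauto
  · intro k hk
    rw [Finset.mem_filter, Finset.mem_Icc] at hk
    exact hk.1.1
  · intro k hk m hm hmk
    rw [Finset.mem_filter, Finset.mem_Icc] at *
    have := sp_add hl hm k hmk (by omega)
    omega

lemma colB_le_len {l : ℕ → ℕ} (hl : IsStrictPartition l) {j : ℕ} (hj : spLength l < j) :
    colB l j ≤ spLength l := by
  by_contra hc
  have h1 := (le_colB hl (k := spLength l + 1) (j := j) (by omega) (by omega)).mp (by omega)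
  have h2 := (le_spLength hl (i := spLength l + 1) (by omega)).not.mp (by omega)
  omega

lemma colB_anti {l : ℕ → ℕ} (hl : IsStrictPartition l) {j j' : ℕ} (hj : spLength l < j)
    (hjj : j < j') : colB l j' ≤ colB l j := by
  by_cases h0 : colB l j' = 0
  · omega
  have h1 := colB_le_len hl (hj.trans hjj)
  have h2 := (le_colB hl (k := colB l j') (j := j') (by omega) (by omega)).mp le_rfl
  exact (le_colB hl (k := colB l j') (j := j) (by omega) (by omega)).mpr (by omega)

lemma len_lt {l : ℕ → ℕ} (hl : IsStrictPartition l) {i : ℕ} (hi : 1 ≤ i) (hil : i ≤ spLength l) :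
    spLength l < l i + i := by
  have h0 := (le_spLength hl (i := spLength l) (by omega)).mp le_rfl
  have := sp_add hl hi _ hil h0
  omega

noncomputable def psi (l : ℕ → ℕ) (i j : ℕ) : ℕ :=
  if j ≤ spLength l then l i - l j else l i + colB l j - j

lemma psi_low {l : ℕ → ℕ} (hl : IsStrictPartition l) {i j : ℕ} (hi : 1 ≤ i)
    (hij : i < j) (hjl : j ≤ spLength l) : 1 ≤ l j ∧ l j < l i := by
  have h0 := (le_spLength hl (i := j) (by omega)).mp hjl
  have h1 := (le_spLength hl (i := i) (by omega)).mp (by omega)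
  exact ⟨by omega, sp_lt hl hi h1 j hij⟩

lemma psi_high {l : ℕ → ℕ} (hl : IsStrictPartition l) {i j : ℕ} (hi : 1 ≤ i)
    (hij : i < j) (hj : j < l i + i) (hjl : spLength l < j) :
    j + 1 ≤ l i + colB l j ∧ colB l j + 1 ≤ j := by
  have h1 := (le_colB hl hi hij.le).mpr hj
  have h2 := colB_le_len hl hjl
  omega

lemma psi_prod {l : ℕ → ℕ} (hl : IsStrictPartition l) {i : ℕ} (hi : 1 ≤ i)
    (hil : i ≤ spLength l) :
    ∏ j ∈ Finset.Ioo i (l i + i), psi l i j = (l i - 1).factorial := by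
  have hi0 := (le_spLength hl hi).mp hil
  have hinj : Set.InjOn (psi l i) (Finset.Ioo i (l i + i) : Finset ℕ) := by
    have key : ∀ a b, i < a → a < b → b < l i + i → psi l i a ≠ psi l i b := by
      intro a b ha hab hb
      unfold psi
      split_ifs with h1 h2 h2
      · have h3 := psi_low hl hi ha h1
        have h4 := psi_low hl hi (by omega) h2
        have h5 := sp_lt hl (i := a) (by omega) (by omega) b hab
        omega
      · have h3 := psi_low hl hi ha h1
        have h4 := psi_high hl hi (by omega) hb (by omega)
        have h5 := le_colB hl (k := a) (j := b) (by omega) (by omega)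
        omega
      · omega
      · have h3 := psi_high hl hi ha (by omega) (by omega)
        have h4 := psi_high hl hi (by omega) hb (by omega)
        have h5 := colB_anti hl (j := a) (j' := b) (by omega) hab
        omega
    intro a ha b hb hab
    simp only [Finset.coe_Ioo, Set.mem_Ioo] at ha hb
    rcases lt_trichotomy a b with h | h | h
    · exact absurd hab (key a b ha.1 h hb.2)
    · exact h
    · exact absurd hab.symm (key b a hb.1 h ha.2)
  have him : (Finset.Ioo i (l i + i)).image (psi l i) = Finset.Icc 1 (l i - 1) := by
    apply Finset.eq_of_subset_of_card_le
    · intro x hx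
      obtain ⟨j, hj, rfl⟩ := Finset.mem_image.mp hx
      rw [Finset.mem_Ioo] at hj
      rw [Finset.mem_Icc]
      unfold psi
      split_ifs with h
      · have := psi_low hl hi hj.1 h
        omega
      · have := psi_high hl hi hj.1 hj.2 (by omega)
        omega
    · rw [Finset.card_image_of_injOn hinj]
      simp
  rw [← prod_Icc_fact, ← him, Finset.prod_image hinj]

lemma rowB {l : ℕ → ℕ} (hl : IsStrictPartition l) {i : ℕ} (hi : 1 ≤ i)
    (hil : i ≤ spLength l) :
    (∏ j ∈ Finset.Ico i (l i + i), hB l (i, j)) *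
      ∏ j ∈ Finset.Ioc i (spLength l), ((l i : ℤ) - l j) =
    ((l i).factorial : ℤ) * ∏ j ∈ Finset.Ioc i (spLength l), ((l i : ℤ) + l j) := by
  have hi0 := (le_spLength hl hi).mp hil
  have hlen := len_lt hl hi hil
  have hsplit : ∀ a : ℕ → ℤ, ∏ j ∈ Finset.Ioc i (spLength l), a j =
      ∏ j ∈ Finset.Ioo i (l i + i), if j ≤ spLength l then a j else 1 := by
    intro a
    rw [← Finset.prod_filter]
    apply Finset.prod_congr _ (fun _ _ => rfl)
    ext j
    simp only [Finset.mem_filter, Finset.mem_Ioo, Finset.mem_Ioc]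
    omega
  have hfac : ((l i).factorial : ℤ) = l i * ∏ j ∈ Finset.Ioo i (l i + i), (psi l i j : ℤ) := by
    rw [← Nat.mul_factorial_pred hi0, ← psi_prod hl hi hil]
    push_cast
    rfl
  have hdiag : hB l (i, i) = l i := by simp [hB]
  rw [← Finset.Ioo_insert_left (show i < l i + i by omega), Finset.prod_insert (by simp), hdiag,
    hsplit, hsplit, hfac, mul_assoc, mul_assoc, ← Finset.prod_mul_distrib,
    ← Finset.prod_mul_distrib]
  congr 1
  refine Finset.prod_congr rfl fun j hj => ?_
  rw [Finset.mem_Ioo] at hj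
  simp only [hB, psi]
  rw [if_neg (by omega)]
  split_ifs with h
  · have := psi_low hl hi hj.1 h
    push_cast [this.2.le]
    ring
  · have := psi_high hl hi hj.1 hj.2 (by omega)
    push_cast [show j ≤ l i + colB l j by omega]
    ring

lemma rowD {l : ℕ → ℕ} (hl : IsStrictPartition l) {i : ℕ} (hi : 1 ≤ i)
    (hil : i ≤ spLength l) :
    ∏ j ∈ Finset.Ioc i (l i + i), hD l (i, j) = ∏ j ∈ Finset.Ico i (l i + i), hB l (i, j) := by
  have hlen := len_lt hl hi hil
  have hcl : colB l (spLength l) = spLength l := by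
    apply le_antisymm (colB_le hl _)
    rw [le_colB hl (by omega) le_rfl]
    have := (le_spLength hl (i := spLength l) (by omega)).mp le_rfl
    omega
  refine Finset.prod_nbij' (fun j => if j ≤ spLength l then j else if j = spLength l + 1 then i
    else j - 1) (fun j => if j = i then spLength l + 1 else if j ≤ spLength l then j else j + 1)
    ?_ ?_ ?_ ?_ ?_
  · intro j hj
    simp only [Finset.mem_Ioc, Finset.mem_Ico] at *
    split_ifs <;> omega
  · intro j hj
    simp only [Finset.mem_Ioc, Finset.mem_Ico] at *
    split_ifs <;> omega
  · intro j hj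
    simp only [Finset.mem_Ioc] at *
    split_ifs <;> omega
  · intro j hj
    simp only [Finset.mem_Ico] at *
    split_ifs <;> omega
  · intro j hj
    simp only [Finset.mem_Ioc] at hj
    simp only [hB, hD]
    by_cases h1 : j ≤ spLength l
    · simp only [h1, if_true]
      rw [if_neg (by omega)]
    · simp only [h1, if_false]
      by_cases h2 : j = spLength l + 1
      · subst h2
        simp only [if_true, Nat.add_sub_cancel, hcl]
        push_cast
        ring
      · simp only [h2, if_false]
        rw [if_neg (by omega), if_neg (by omega)]
        push_cast [show 1 ≤ j by omega]
        ring

lemma prodB {l : ℕ → ℕ} (hl : IsStrictPartition l) :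
    ∏ p ∈ cellsB l, hB l p =
      ∏ i ∈ Finset.Icc 1 (spLength l), ∏ j ∈ Finset.Ico i (l i + i), hB l (i, j) := by
  apply Finset.prod_finset_product
  rintro ⟨a, b⟩
  rw [mem_cellsB hl]
  simp only [Finset.mem_Icc, Finset.mem_Ico]
  constructor
  · rintro ⟨h1, h2, h3⟩
    exact ⟨⟨h1, (le_spLength hl h1).mpr (by omega)⟩, h2, h3⟩
  · rintro ⟨⟨h1, _⟩, h2, h3⟩
    exact ⟨h1, h2, h3⟩

lemma prodD {l : ℕ → ℕ} (hl : IsStrictPartition l) :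
    ∏ p ∈ cellsD l, hD l p =
      ∏ i ∈ Finset.Icc 1 (spLength l), ∏ j ∈ Finset.Ioc i (l i + i), hD l (i, j) := by
  apply Finset.prod_finset_product
  rintro ⟨a, b⟩
  rw [mem_cellsD hl]
  simp only [Finset.mem_Icc, Finset.mem_Ioc]
  constructor
  · rintro ⟨h1, h2, h3⟩
    exact ⟨⟨h1, (le_spLength hl h1).mpr (by omega)⟩, h2, h3⟩
  · rintro ⟨⟨h1, _⟩, h2, h3⟩
    exact ⟨h1, h2, h3⟩

lemma Gq_mul_prodB {l : ℕ → ℕ} (hl : IsStrictPartition l) :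
    Gq l (spLength l) * ((∏ p ∈ cellsB l, hB l p : ℤ) : ℚ) = 1 := by
  rw [prodB hl, Gq]
  push_cast
  rw [← Finset.prod_mul_distrib]
  refine Finset.prod_eq_one fun i hi => ?_
  rw [Finset.mem_Icc] at hi
  have hrow := congrArg (fun z : ℤ => (z : ℚ)) (rowB hl hi.1 hi.2)
  push_cast at hrow
  have hg : ∏ j ∈ Finset.Ioc i (spLength l), gq (l i) (l j) =
      (∏ j ∈ Finset.Ioc i (spLength l), ((l i : ℚ) - l j)) /
      ∏ j ∈ Finset.Ioc i (spLength l), ((l i : ℚ) + l j) := by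
    rw [← Finset.prod_div_distrib]
    refine Finset.prod_congr rfl fun j hj => ?_
    rw [Finset.mem_Ioc] at hj
    have := psi_low hl hi.1 hj.1 hj.2
    rw [gq, if_neg (by omega)]
  have hne : ∏ j ∈ Finset.Ioc i (spLength l), ((l i : ℚ) + l j) ≠ 0 := by
    rw [Finset.prod_ne_zero_iff]
    intro j hj
    rw [Finset.mem_Ioc] at hj
    have := psi_low hl hi.1 hj.1 hj.2
    have : l i + l j ≠ 0 := by omega
    exact_mod_cast this
  have hf : ((l i).factorial : ℚ) ≠ 0 := by positivity
  rw [hg]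
  field_simp
  linear_combination hrow

lemma spSize_eq {l : ℕ → ℕ} (hl : IsStrictPartition l) :
    ∑ i ∈ Finset.Icc 1 (spLength l), l i = spSize l := by
  unfold spSize
  apply Finset.sum_subset
  · intro i hi
    rw [Finset.mem_Icc] at *
    have h := (le_spLength hl hi.1).mp hi.2
    have := sp_add hl le_rfl i hi.1 h
    omega
  · intro i hi hni
    rw [Finset.mem_Icc] at *
    by_contra h
    exact hni ⟨hi.1, (le_spLength hl hi.1).mpr h⟩

/-- The shifted hook-length formula (types B and D). -/
theorem statement13 (l : ℕ → ℕ) (hl : IsStrictPartition l) :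
    (fB l (fun _ => 0) : ℤ) * (∏ p ∈ cellsB l, hB l p) = (Nat.factorial (spSize l) : ℤ) ∧
    (fB l (fun _ => 0) : ℤ) * (∏ p ∈ cellsD l, hD l p) = (Nat.factorial (spSize l) : ℤ) := by
  have hsk : skewB l (fun _ => 0) = cellsB l := by
    simp [skewB, cellsB]
  have hB' : (fB l (fun _ => 0) : ℤ) * (∏ p ∈ cellsB l, hB l p) =
      (Nat.factorial (spSize l) : ℤ) := by
    have h := main_count (spLength l) (spSize l) l hl ?_ (spSize_eq hl)
    · have h2 := Gq_mul_prodB hl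
      unfold fB
      rw [hsk]
      have : ((Nat.card {T // IsSYT (cellsB l) T} : ℚ)) * ((∏ p ∈ cellsB l, hB l p : ℤ) : ℚ) =
          (Nat.factorial (spSize l) : ℚ) := by
        rw [h, mul_assoc, h2, mul_one]
      exact_mod_cast this
    · intro i hi
      by_contra h
      have := (le_spLength hl (by omega)).mpr h
      omega
  refine ⟨hB', ?_⟩
  rw [prodD hl, ← hB', prodB hl]
  congr 1
  refine Finset.prod_congr rfl fun i hi => ?_
  rw [Finset.mem_Icc] at hi
  exact rowD hl hi.1 hi.2
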